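/- arXiv:1002.2060 — 2 statements merged into one kernel-verified Lean document; each statement's English description precedes it below -/
import Mathlib

section
/- Let α, β ≥ 0 be real numbers and n ≥ 0 an integer. There exists a monic real polynomial p of degree n with sup_{t ∈ [0,1]} t^α (1−t)^β |p(t)| = E_n(α,β) together with n+1 points 0 ≤ η_0 < η_1 < ... < η_n ≤ 1 such that η_k^α (1−η_k)^β p(η_k) = (−1)^{n−k} E_n(α,β) for every k = 0, 1, ..., n; that is, the weighted extremal function t^α (1−t)^β p(t) equioscillates between its extreme values ±E_n(α,β) at n+1 alternation points. -/
/-- The weighted sup norm `sup_{t ∈ [0,1]} t^α (1-t)^β |p(t)|` (real `rpow`, so `0^0 = 1`). -/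
noncomputable def intervalSup (a b : ℝ) (p : Polynomial ℝ) : ℝ :=
  sSup ((fun t : ℝ => t ^ a * (1 - t) ^ b * |p.eval t|) '' Set.Icc (0 : ℝ) 1)

/-- The 1-D weighted Chebyshev constant `E_m(α,β)`: infimum over monic real polynomials of
degree `m` of `sup_{t ∈ [0,1]} t^α (1-t)^β |p(t)|`. -/
noncomputable def devE (m : ℕ) (a b : ℝ) : ℝ :=
  sInf {r : ℝ | ∃ p : Polynomial ℝ, p.Monic ∧ p.natDegree = m ∧ r = intervalSup a b p}

open Polynomial Set in
/-- Given disjoint closed sets `A`, `B` of reals with `A` bounded above, either there are `n + 1`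
points lying alternately in `A` and `B`, the largest one in `A`, or a monic polynomial of degree at
most `n` is negative on `A` and positive on `B`. -/
theorem exists_alternating_or_exists_monic_separating (n : ℕ) :
    ∀ A B : Set ℝ, IsClosed A → IsClosed B → Disjoint A B → BddAbove A →
      (∃ η : Fin (n + 1) → ℝ, StrictAnti η ∧
        ∀ k : Fin (n + 1), (Even (k : ℕ) → η k ∈ A) ∧ (¬ Even (k : ℕ) → η k ∈ B)) ∨
      ∃ q : ℝ[X], q.Monic ∧ q.natDegree ≤ n ∧ (∀ x ∈ A, q.eval x < 0) ∧ ∀ x ∈ B, 0 < q.eval x := by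
  induction n with
  | zero =>
    intro A B _ _ _ _
    rcases A.eq_empty_or_nonempty with rfl | ⟨a, ha⟩
    · exact Or.inr ⟨1, monic_one, by simp, by simp, by simp⟩
    · exact Or.inl ⟨fun _ => a, fun i j hij => by lia, fun k => by simp [ha]⟩
  | succ n ih =>
    intro A B hA hB hAB hbdd
    rcases A.eq_empty_or_nonempty with rfl | hne
    · exact Or.inr ⟨1, monic_one, by simp, by simp, by simp⟩
    set a := sSup A
    have haA : a ∈ A := hA.csSup_mem hne hbdd
    have hle : ∀ x ∈ A, x ≤ a := fun x hx => le_csSup hbdd hx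
    have haB : a ∉ B := disjoint_left.1 hAB haA
    have hdisj : Disjoint (B ∩ Iic a) (A ∪ Ici a) := by
      rw [disjoint_left]
      rintro x ⟨hxB, hxa⟩ (hxA | hax)
      · exact disjoint_left.1 hAB hxA hxB
      · exact haB (le_antisymm hxa (mem_Ici.1 hax) ▸ hxB)
    rcases ih (B ∩ Iic a) (A ∪ Ici a) (hB.inter isClosed_Iic) (hA.union isClosed_Ici) hdisj
      ⟨a, fun x hx => hx.2⟩ with ⟨η, hη, hmem⟩ | ⟨q, hq, hdeg, hneg, hpos⟩
    · left
      have h0 : η 0 < a := by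
        obtain ⟨h1, h2⟩ := (hmem 0).1 (by simp)
        exact lt_of_le_of_ne h2 fun h => haB (h ▸ h1)
      have hlt : ∀ k, η k < a := fun k => (hη.antitone (Fin.zero_le k)).trans_lt h0
      refine ⟨Fin.cons a η, ?_, ?_⟩
      · rw [Fin.strictAnti_iff_succ_lt]
        intro i
        refine Fin.cases ?_ (fun j => ?_) i
        · simpa using h0
        · simpa [← Fin.succ_castSucc] using hη (Fin.castSucc_lt_succ (i := j))
      · intro k
        refine Fin.cases ?_ (fun j => ?_) k
        · simp [haA]
        · simp only [Fin.val_succ, Fin.cons_succ, Nat.even_add_one, not_not]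
          refine ⟨fun h => ?_, fun h => ((hmem j).1 h).1⟩
          exact ((hmem j).2 h).resolve_right (not_le.2 (hlt j))
    · right
      obtain ⟨δ, hδ, hball⟩ := Metric.isOpen_iff.1 hB.isOpen_compl a haB
      have hfar : ∀ x ∈ B, a < x → a + δ ≤ x := by
        intro x hx hax
        by_contra! h
        exact hball (by rw [Metric.mem_ball, Real.dist_eq, abs_lt]; constructor <;> linarith) hx
      refine ⟨q * (X - C (a + δ / 2)), hq.mul (monic_X_sub_C _), ?_, fun x hx => ?_, fun x hx => ?_⟩
      · rw [hq.natDegree_mul (monic_X_sub_C _), natDegree_X_sub_C]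
        lia
      · have h1 := hpos x (Or.inl hx)
        have h2 := hle x hx
        simp only [eval_mul, eval_sub, eval_X, eval_C]
        exact mul_neg_of_pos_of_neg h1 (by linarith)
      · simp only [eval_mul, eval_sub, eval_X, eval_C]
        rcases le_or_gt x a with hxa | hax
        · exact mul_pos_of_neg_of_neg (hneg x ⟨hx, hxa⟩) (by linarith)
        · exact mul_pos (hpos x (Or.inr hax.le)) (by linarith [hfar x hx hax])

/-- If `h` has the sign opposite to `f` wherever `|f|` attains the bound `E`, then a small multiple
of `h` decreases the norm of `f`. -/
theorem exists_pos_norm_add_smul_lt {K : Type*} [TopologicalSpace K] [CompactSpace K]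
    (f h : C(K, ℝ)) {E : ℝ} (hE : 0 < E) (hf : ‖f‖ ≤ E) (hfh : ∀ t, |f t| = E → f t * h t < 0) :
    ∃ ε : ℝ, 0 < ε ∧ ‖f + ε • h‖ < E := by
  have hfE : ∀ t, |f t| ≤ E := fun t => (f.norm_coe_le_norm t).trans hf
  obtain ⟨E', hE', hE'E, hS⟩ : ∃ E', 0 ≤ E' ∧ E' < E ∧ ∀ t, 0 ≤ f t * h t → |f t| ≤ E' := by
    have hcomp : IsCompact {t | 0 ≤ f t * h t} :=
      (isClosed_le continuous_const (f.continuous.mul h.continuous)).isCompact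
    rcases Set.eq_empty_or_nonempty {t | 0 ≤ f t * h t} with hemp | hne
    · exact ⟨0, le_rfl, hE, fun t ht => (Set.notMem_empty t (hemp ▸ ht)).elim⟩
    · obtain ⟨s, hs, hmax⟩ := hcomp.exists_isMaxOn hne f.continuous.abs.continuousOn
      exact ⟨|f s|, abs_nonneg _, lt_of_le_of_ne (hfE s) fun h0 => (hfh s h0).not_ge hs,
        fun t ht => hmax ht⟩
  have hM : 0 < ‖h‖ + 1 := by positivity
  refine ⟨(E - E') / (‖h‖ + 1), div_pos (sub_pos.2 hE'E) hM, ?_⟩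
  set ε := (E - E') / (‖h‖ + 1) with hε
  have hεpos : 0 < ε := div_pos (sub_pos.2 hE'E) hM
  have hεM : ε * (‖h‖ + 1) = E - E' := div_mul_cancel₀ _ hM.ne'
  rw [ContinuousMap.norm_lt_iff _ hE]
  intro t
  have ht : |h t| ≤ ‖h‖ := h.norm_coe_le_norm t
  have hεh : |ε * h t| < E - E' := by
    rw [abs_mul, abs_of_pos hεpos]
    nlinarith
  simp only [ContinuousMap.add_apply, ContinuousMap.smul_apply, smul_eq_mul, Real.norm_eq_abs]
  rcases le_or_gt 0 (f t * h t) with h0 | h0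
  · linarith [abs_add_le (f t) (ε * h t), hS t h0]
  · have h1 := abs_le.1 (hfE t)
    have h2 := abs_lt.1 hεh
    rw [abs_lt]
    rcases mul_neg_iff.1 h0 with ⟨h3, h4⟩ | ⟨h3, h4⟩
    · have := mul_neg_of_pos_of_neg hεpos h4
      constructor <;> linarith
    · have := mul_pos hεpos h4
      constructor <;> linarith

/-- The weight `t^a (1-t)^b` as a continuous function on `[0,1]`. -/
noncomputable def jacobiWeight {a b : ℝ} (ha : 0 ≤ a) (hb : 0 ≤ b) : C(Set.Icc (0 : ℝ) 1, ℝ) where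
  toFun t := (t : ℝ) ^ a * (1 - (t : ℝ)) ^ b
  continuous_toFun :=
    ((Real.continuous_rpow_const ha).comp continuous_subtype_val).mul
      ((Real.continuous_rpow_const hb).comp (continuous_const.sub continuous_subtype_val))

/-- Multiplication of polynomials by the weight `t^a (1-t)^b`, as a linear map into `C([0,1])`. -/
noncomputable def weightedPolynomial {a b : ℝ} (ha : 0 ≤ a) (hb : 0 ≤ b) :
    Polynomial ℝ →ₗ[ℝ] C(Set.Icc (0 : ℝ) 1, ℝ) :=
  LinearMap.mulLeft ℝ (jacobiWeight ha hb) ∘ₗ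
    (Polynomial.toContinuousMapOnAlgHom (Set.Icc (0 : ℝ) 1)).toLinearMap

theorem weightedPolynomial_apply {a b : ℝ} (ha : 0 ≤ a) (hb : 0 ≤ b) (p : Polynomial ℝ)
    (t : Set.Icc (0 : ℝ) 1) :
    weightedPolynomial ha hb p t = (t : ℝ) ^ a * (1 - (t : ℝ)) ^ b * p.eval (t : ℝ) := rfl

theorem jacobiWeight_nonneg {t : ℝ} (ht : t ∈ Set.Icc (0 : ℝ) 1) (a b : ℝ) :
    0 ≤ t ^ a * (1 - t) ^ b :=
  mul_nonneg (Real.rpow_nonneg ht.1 _) (Real.rpow_nonneg (sub_nonneg.2 ht.2) _)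

theorem intervalSup_eq_norm {a b : ℝ} (ha : 0 ≤ a) (hb : 0 ≤ b) (p : Polynomial ℝ) :
    intervalSup a b p = ‖weightedPolynomial ha hb p‖ := by
  rw [intervalSup, sSup_image', ContinuousMap.norm_eq_iSup_norm]
  congr 1
  ext t
  rw [weightedPolynomial_apply, Real.norm_eq_abs, abs_mul, abs_of_nonneg (jacobiWeight_nonneg t.2 a b)]

theorem weightedPolynomial_ne_zero {a b : ℝ} (ha : 0 ≤ a) (hb : 0 ≤ b) {p : Polynomial ℝ}
    (hp : p ≠ 0) : weightedPolynomial ha hb p ≠ 0 := by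
  refine fun h => hp (Polynomial.eq_zero_of_infinite_isRoot p
    ((Set.Ioo_infinite (zero_lt_one (α := ℝ))).mono fun t ht => ?_))
  have h1 := DFunLike.congr_fun h ⟨t, ht.1.le, ht.2.le⟩
  rw [weightedPolynomial_apply] at h1
  exact (mul_eq_zero.1 h1).resolve_left
    (mul_pos (Real.rpow_pos_of_pos ht.1 _) (Real.rpow_pos_of_pos (sub_pos.2 ht.2) _)).ne'

/-- In a finite-dimensional subspace `W`, the norm of `f + v` attains its minimum over `v ∈ W`. -/
theorem Submodule.exists_forall_norm_add_le {V : Type*} [NormedAddCommGroup V] [NormedSpace ℝ V]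
    (W : Submodule ℝ V) [FiniteDimensional ℝ W] (f : V) :
    ∃ v ∈ W, ∀ u ∈ W, ‖f + v‖ ≤ ‖f + u‖ := by
  have : ProperSpace W := FiniteDimensional.proper ℝ W
  obtain ⟨v, hv⟩ := Continuous.exists_forall_le (f := fun v : W => ‖f + v‖)
    (continuous_const.add continuous_subtype_val).norm
    (Filter.tendsto_atTop_mono (f := fun v : W => ‖v‖ + -‖f‖)
      (fun v => by
        have := norm_sub_norm_le (v : V) (-f)
        rw [norm_neg, sub_neg_eq_add, add_comm (v : V)] at this
        simpa [sub_eq_add_neg] using this)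
      (Filter.tendsto_atTop_add_const_right _ _ (tendsto_norm_cocompact_atTop (E := W))))
  exact ⟨v, v.2, fun u hu => hv ⟨u, hu⟩⟩

open Polynomial in
theorem exists_monic_forall_intervalSup_le {a b : ℝ} (ha : 0 ≤ a) (hb : 0 ≤ b) (n : ℕ) :
    ∃ p : ℝ[X], p.Monic ∧ p.natDegree = n ∧
      ∀ q : ℝ[X], q.Monic → q.natDegree = n → intervalSup a b p ≤ intervalSup a b q := by
  obtain ⟨_, ⟨r, hr, rfl⟩, hmin⟩ := Submodule.exists_forall_norm_add_le
    ((degreeLT ℝ n).map (weightedPolynomial ha hb)) (weightedPolynomial ha hb (X ^ n))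
  have hr' : r.degree < n := mem_degreeLT.1 hr
  refine ⟨X ^ n + r, monic_X_pow_add hr', ?_, fun q hq hdeg => ?_⟩
  · rw [natDegree_add_eq_left_of_degree_lt (by simpa using hr'), natDegree_X_pow]
  · have hlt : (q - X ^ n).degree < (n : WithBot ℕ) := by
      have hqd : q.degree = n := by rw [degree_eq_natDegree hq.ne_zero, hdeg]
      have := degree_sub_lt_left (p := q) (q := X ^ n) (by simp [hqd]) hq.ne_zero (by simp [hq.leadingCoeff])
      rwa [hqd] at this
    have := hmin _ ⟨q - X ^ n, mem_degreeLT.2 hlt, rfl⟩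
    rw [← map_add, ← map_add, add_sub_cancel] at this
    rwa [intervalSup_eq_norm ha hb, intervalSup_eq_norm ha hb]

/-- for `α, β ≥ 0` and `n ≥ 0` there is an extremal monic polynomial `p` of degree
`n` for `E_n(α,β)` whose weighted extremal function `t^α (1-t)^β p(t)` equioscillates between
`±E_n(α,β)` at `n+1` alternation points `0 ≤ η₀ < ⋯ < ηₙ ≤ 1`. -/
theorem exists_extremal_equioscillating (a b : ℝ) (ha : 0 ≤ a) (hb : 0 ≤ b) (n : ℕ) :
    ∃ p : Polynomial ℝ, p.Monic ∧ p.natDegree = n ∧ intervalSup a b p = devE n a b ∧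
      ∃ η : Fin (n + 1) → ℝ, StrictMono η ∧ (∀ k, η k ∈ Set.Icc (0 : ℝ) 1) ∧
        ∀ k : Fin (n + 1),
          η k ^ a * (1 - η k) ^ b * p.eval (η k) = (-1 : ℝ) ^ (n - (k : ℕ)) * devE n a b := by
  obtain ⟨p, hp, hdeg, hmin⟩ := exists_monic_forall_intervalSup_le ha hb n
  have hpE : intervalSup a b p = devE n a b :=
    (IsLeast.csInf_eq (s := {r | ∃ q : Polynomial ℝ, q.Monic ∧ q.natDegree = n ∧
      r = intervalSup a b q}) ⟨⟨p, hp, hdeg, rfl⟩, by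
        rintro _ ⟨q, hq, hqn, rfl⟩
        exact hmin q hq hqn⟩).symm
  refine ⟨p, hp, hdeg, hpE, ?_⟩
  rw [← hpE]
  set Φ := weightedPolynomial ha hb with hΦ
  set E := intervalSup a b p with hE
  have hnorm : ‖Φ p‖ = E := (intervalSup_eq_norm ha hb p).symm
  have hEpos : 0 < E := hnorm ▸ norm_pos_iff.2 (weightedPolynomial_ne_zero ha hb hp.ne_zero)
  have hclosed : ∀ c : ℝ, IsClosed ((↑) '' {t : Set.Icc (0 : ℝ) 1 | Φ p t = c} : Set ℝ) := fun c =>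
    isClosed_Icc.isClosedEmbedding_subtypeVal.isClosedMap _
      (isClosed_eq (Φ p).continuous continuous_const)
  rcases exists_alternating_or_exists_monic_separating n _ _ (hclosed E) (hclosed (-E))
    (by
      rw [Set.disjoint_left]
      rintro _ ⟨s, hs, rfl⟩ ⟨t, ht, hts⟩
      rw [Subtype.ext hts] at ht
      have hs' : Φ p s = E := hs
      have ht' : Φ p s = -E := ht
      linarith)
    ⟨1, by rintro _ ⟨s, _, rfl⟩; exact s.2.2⟩ with ⟨η, hη, hmem⟩ | ⟨q, hq, hqn, hneg, hpos⟩
  · have key : ∀ k, η k ∈ Set.Icc (0 : ℝ) 1 ∧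
        η k ^ a * (1 - η k) ^ b * p.eval (η k) = (-1 : ℝ) ^ (k : ℕ) * E := by
      intro k
      by_cases hk : Even (k : ℕ)
      · obtain ⟨t, ht, htk⟩ := (hmem k).1 hk
        rw [← htk, hk.neg_one_pow, one_mul]
        exact ⟨t.2, ht⟩
      · obtain ⟨t, ht, htk⟩ := (hmem k).2 hk
        rw [← htk, (Nat.not_even_iff_odd.1 hk).neg_one_pow, neg_one_mul]
        exact ⟨t.2, ht⟩
    refine ⟨fun k => η k.rev, fun i j hij => hη (Fin.rev_lt_rev.2 hij), fun k => (key _).1,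
      fun k => ?_⟩
    rw [(key k.rev).2, Fin.val_rev, Nat.add_sub_add_right]
  · exfalso
    obtain ⟨ε, hε, hlt⟩ := exists_pos_norm_add_smul_lt (Φ p) (Φ q) hEpos hnorm.le (by
      intro t ht
      have hw := jacobiWeight_nonneg t.2 a b
      have hw0 : (t : ℝ) ^ a * (1 - (t : ℝ)) ^ b ≠ 0 := by
        intro h0
        rw [hΦ, weightedPolynomial_apply, h0, zero_mul, abs_zero] at ht
        exact hEpos.ne ht
      have hwpos := lt_of_le_of_ne hw hw0.symm
      rcases (abs_eq hEpos.le).1 ht with h | h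
      · rw [h]
        exact mul_neg_of_pos_of_neg hEpos (mul_neg_of_pos_of_neg hwpos (hneg t ⟨t, h, rfl⟩))
      · rw [h]
        exact mul_neg_of_neg_of_pos (neg_lt_zero.2 hEpos) (mul_pos hwpos (hpos t ⟨t, h, rfl⟩)))
    have hcn : 0 ≤ q.coeff n := by
      rcases hqn.lt_or_eq with h | h
      · exact (Polynomial.coeff_eq_zero_of_natDegree_lt h).ge
      · rw [← h, hq.coeff_natDegree]
        exact zero_le_one
    set c := 1 + ε * q.coeff n with hc
    have hc1 : 1 ≤ c := le_add_of_nonneg_right (mul_nonneg hε.le hcn)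
    have hc0 : 0 < c := zero_lt_one.trans_le hc1
    have hcoeff : (c⁻¹ • (p + ε • q)).coeff n = 1 := by
      have hpn : p.coeff n = 1 := hdeg ▸ hp.coeff_natDegree
      rw [Polynomial.coeff_smul, Polynomial.coeff_add, Polynomial.coeff_smul, hpn, smul_eq_mul,
        smul_eq_mul, inv_mul_cancel₀ hc0.ne']
    have hle : (c⁻¹ • (p + ε • q)).natDegree ≤ n :=
      (Polynomial.natDegree_smul_le _ _).trans (Polynomial.natDegree_add_le_of_degree_le hdeg.le
        ((Polynomial.natDegree_smul_le _ _).trans hqn))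
    have h1 := hmin _ (Polynomial.monic_of_natDegree_le_of_coeff_eq_one n hle hcoeff)
      (Polynomial.natDegree_eq_of_le_of_coeff_ne_zero hle (by rw [hcoeff]; exact one_ne_zero))
    rw [intervalSup_eq_norm ha hb (c⁻¹ • (p + ε • q)), map_smul, map_add, map_smul, norm_smul,
      Real.norm_of_nonneg (inv_nonneg.2 hc0.le)] at h1
    have h2 := mul_le_of_le_one_left (norm_nonneg (Φ p + ε • Φ q)) (inv_le_one_of_one_le₀ hc1)
    exact absurd hlt (not_lt.2 (h1.trans h2))
end

section
/- Let (m_j) be a sequence of natural numbers with m_j → ∞ and let (α_j), (β_j) be sequences of nonnegative real numbers; set s_j = m_j + α_j + β_j and assume the limits a = lim α_j/s_j and b = lim β_j/s_j exist (so a, b ≥ 0 and a + b ≤ 1). Then lim_{j→∞} E_{m_j}(α_j, β_j)^{1/s_j} = ((1−a−b)/2)^{(1−a−b)/2} · ((1+a+b)/2)^{(1+a+b)/2} · ((1−a+b)/2)^{(1−a+b)/2} · ((1+a−b)/2)^{(1+a−b)/2}, where x^y is real rpow with 0^0 = 1. -/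
open Polynomial Filter Topology
open scoped Nat

/-- Integration over `[0,1]` as a linear functional on real polynomials. -/
noncomputable def unitIntegral : ℝ[X] →ₗ[ℝ] ℝ where
  toFun p := ∫ t in (0 : ℝ)..1, p.eval t
  map_add' p q := by
    simp only [eval_add]
    exact intervalIntegral.integral_add (p.continuous.intervalIntegrable _ _)
      (q.continuous.intervalIntegrable _ _)
  map_smul' c p := by simp

lemma unitIntegral_apply (p : ℝ[X]) : unitIntegral p = ∫ t in (0 : ℝ)..1, p.eval t := rfl

lemma unitIntegral_C_mul (c : ℝ) (p : ℝ[X]) : unitIntegral (C c * p) = c * unitIntegral p := by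
  rw [← smul_eq_C_mul, map_smul, smul_eq_mul]

lemma unitIntegral_nonneg {p : ℝ[X]} (h : ∀ t ∈ Set.Icc (0 : ℝ) 1, 0 ≤ p.eval t) :
    0 ≤ unitIntegral p :=
  intervalIntegral.integral_nonneg zero_le_one h

lemma unitIntegral_mul_derivative (p q : ℝ[X]) :
    unitIntegral (p * derivative q) =
      p.eval 1 * q.eval 1 - p.eval 0 * q.eval 0 - unitIntegral (derivative p * q) := by
  simp only [unitIntegral_apply, eval_mul]
  exact intervalIntegral.integral_mul_deriv_eq_deriv_mul (fun x _ => p.hasDerivAt x)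
    (fun x _ => q.hasDerivAt x) ((derivative p).continuous.intervalIntegrable _ _)
    ((derivative q).continuous.intervalIntegrable _ _)

lemma unitIntegral_mul_iterate_derivative (n : ℕ) (p F : ℝ[X])
    (h0 : ∀ j < n, (derivative^[j] F).eval 0 = 0) (h1 : ∀ j < n, (derivative^[j] F).eval 1 = 0) :
    unitIntegral (p * derivative^[n] F) = (-1) ^ n * unitIntegral (derivative^[n] p * F) := by
  induction n generalizing p with
  | zero => simp
  | succ n ih =>
    rw [Function.iterate_succ_apply', unitIntegral_mul_derivative, h0 n n.lt_succ_self,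
      h1 n n.lt_succ_self, ih _ (fun j hj => h0 j (hj.trans n.lt_succ_self))
        (fun j hj => h1 j (hj.trans n.lt_succ_self)), ← Function.iterate_succ_apply, pow_succ]
    ring

lemma eval_iterate_derivative_eq_zero {q F : ℝ[X]} {x : ℝ} (hq : q.eval x = 0) {n j : ℕ}
    (hF : q ^ n ∣ F) (hj : j < n) : (derivative^[j] F).eval x = 0 := by
  obtain ⟨r, hr⟩ := pow_sub_dvd_iterate_derivative_of_pow_dvd j hF
  rw [hr, eval_mul, eval_pow, hq, zero_pow (by omega), zero_mul]

lemma eval_zero_iterate_derivative (F : ℝ[X]) (n : ℕ) :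
    (derivative^[n] F).eval 0 = n ! * F.coeff n := by
  rw [← coeff_zero_eq_eval_zero, coeff_iterate_derivative]
  simp [Nat.descFactorial_self]

lemma unitIntegral_beta (a b : ℕ) :
    unitIntegral (X ^ a * (1 - X) ^ b) = a ! * b ! / (a + b + 1)! := by
  induction b generalizing a with
  | zero =>
    simp only [unitIntegral_apply, pow_zero, mul_one, eval_pow, eval_X, integral_pow]
    rw [add_zero, Nat.factorial_succ]
    push_cast
    have : ((a ! : ℕ) : ℝ) ≠ 0 := by positivity
    simp
    field_simp
  | succ b ih =>
    have h := unitIntegral_mul_derivative ((1 - X) ^ (b + 1)) (X ^ (a + 1) : ℝ[X])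
    have e1 : (1 - X : ℝ[X]) ^ (b + 1) * derivative (X ^ (a + 1)) =
        C ((a : ℝ) + 1) * (X ^ a * (1 - X) ^ (b + 1)) := by
      simp; ring
    have e2 : derivative ((1 - X : ℝ[X]) ^ (b + 1)) * X ^ (a + 1) =
        C (-((b : ℝ) + 1)) * (X ^ (a + 1) * (1 - X) ^ b) := by
      simp [derivative_pow]; ring
    rw [e1, e2, unitIntegral_C_mul, unitIntegral_C_mul, ih] at h
    simp only [eval_pow, eval_sub, eval_one, eval_X, sub_self, ne_eq, Nat.add_eq_zero_iff,
      one_ne_zero, and_false, not_false_eq_true, zero_pow, mul_zero, zero_mul] at h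
    rw [show a + 1 + b + 1 = a + (b + 1) + 1 by ring, Nat.factorial_succ a] at h
    rw [Nat.factorial_succ b]
    have h2 : ((a + (b + 1) + 1)! : ℝ) ≠ 0 := by positivity
    have h3 : (a : ℝ) + 1 ≠ 0 := by positivity
    apply mul_left_cancel₀ h3
    rw [h]
    push_cast
    field_simp
    ring

lemma eval_zero_sq_le_unitIntegral {n : ℕ} {p : ℝ[X]} (hp : p.natDegree ≤ n) :
    p.eval 0 ^ 2 ≤ (n + 1 : ℝ) ^ 2 * unitIntegral (p ^ 2) := by
  set F : ℝ[X] := X ^ n * (1 - X) ^ (n + 1) with hF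
  have hF0 : ∀ j < n, (derivative^[j] F).eval 0 = 0 := fun j hj =>
    eval_iterate_derivative_eq_zero (q := X) (by simp) (Dvd.intro _ rfl) hj
  have hF1 : ∀ j < n + 1, (derivative^[j] F).eval 1 = 0 := fun j hj =>
    eval_iterate_derivative_eq_zero (q := 1 - X) (by simp) (Dvd.intro_left _ rfl) hj
  have hcoeff (k : ℕ) : F.coeff (n + k) = ((1 - X : ℝ[X]) ^ (n + 1)).coeff k := by
    rw [hF, add_comm n k, coeff_X_pow_mul]
  have hfac : (n ! : ℝ) ≠ 0 := by positivity
  set Q : ℝ[X] := C (-(n ! : ℝ)⁻¹) * derivative^[n + 1] F with hQ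
  have hrep (q : ℝ[X]) (hq : q.natDegree ≤ n) : unitIntegral (q * Q) = q.eval 0 := by
    rw [hQ, mul_left_comm, unitIntegral_C_mul, Function.iterate_succ_apply',
      unitIntegral_mul_derivative, hF1 n n.lt_succ_self,
      unitIntegral_mul_iterate_derivative n _ F hF0 (fun j hj => hF1 j (hj.trans n.lt_succ_self)),
      ← Function.iterate_succ_apply, iterate_derivative_eq_zero (Nat.lt_succ_of_le hq),
      eval_zero_iterate_derivative, ← add_zero n, hcoeff]
    simp [coeff_zero_eq_eval_zero]
    field_simp
  have hFdeg : F.natDegree ≤ n + (n + 1) := by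
    rw [hF]; compute_degree
  have hQdeg : Q.natDegree ≤ n := by
    refine (natDegree_C_mul_le _ _).trans ((natDegree_iterate_derivative _ _).trans ?_)
    omega
  have hQ0 : Q.eval 0 = (n + 1) ^ 2 := by
    rw [hQ, eval_mul, eval_C, eval_zero_iterate_derivative, hcoeff,
      show ((1 - X : ℝ[X]) ^ (n + 1)).coeff 1 = -(n + 1) by
        have := eval_zero_iterate_derivative ((1 - X : ℝ[X]) ^ (n + 1)) 1
        simp [derivative_pow] at this
        linarith, Nat.factorial_succ]
    push_cast
    field_simp
  set c : ℝ := p.eval 0 / (n + 1) ^ 2 with hc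
  have hpos : 0 ≤ unitIntegral ((p - C c * Q) ^ 2) :=
    unitIntegral_nonneg fun t _ => by rw [eval_pow]; positivity
  have hexp : (p - C c * Q) ^ 2 = p ^ 2 - C (2 * c) * (p * Q) + C (c ^ 2) * (Q * Q) := by
    simp only [C_mul, C_pow, map_ofNat]; ring
  rw [hexp, map_add, map_sub, unitIntegral_C_mul, unitIntegral_C_mul, hrep _ hp, hrep _ hQdeg,
    hQ0] at hpos
  have hn : (0 : ℝ) < (n + 1) ^ 2 := by positivity
  have hpc : p.eval 0 = c * (n + 1) ^ 2 := by rw [hc]; field_simp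
  rw [hpc] at hpos ⊢
  nlinarith

lemma eval_sq_le_unitIntegral_of_half_le {n : ℕ} {p : ℝ[X]} (hp : p.natDegree ≤ n) {x : ℝ}
    (hx : 1 / 2 ≤ x) (hx1 : x ≤ 1) :
    p.eval x ^ 2 ≤ 2 * (n + 1 : ℝ) ^ 2 * unitIntegral (p ^ 2) := by
  have hx0 : 0 < x := by linarith
  have hdeg : (p.comp (C x - C x * X)).natDegree ≤ n := by
    refine natDegree_comp_le.trans ?_
    have : (C x - C x * X : ℝ[X]).natDegree ≤ 1 := by compute_degree
    nlinarith
  have h := eval_zero_sq_le_unitIntegral hdeg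
  have hint : unitIntegral ((p.comp (C x - C x * X)) ^ 2) ≤ 2 * unitIntegral (p ^ 2) := by
    simp only [unitIntegral_apply, eval_pow, eval_comp, eval_sub, eval_mul, eval_C, eval_X]
    rw [intervalIntegral.integral_comp_sub_mul (fun t => p.eval t ^ 2) hx0.ne' x]
    simp only [mul_one, sub_self, mul_zero, sub_zero, smul_eq_mul]
    have hmono : ∫ t in (0 : ℝ)..x, p.eval t ^ 2 ≤ ∫ t in (0 : ℝ)..1, p.eval t ^ 2 :=
      intervalIntegral.integral_mono_interval le_rfl hx0.le hx1
        (Eventually.of_forall fun t => sq_nonneg _)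
        ((p.continuous.pow 2).intervalIntegrable _ _)
    have hnn : 0 ≤ ∫ t in (0 : ℝ)..x, p.eval t ^ 2 :=
      intervalIntegral.integral_nonneg hx0.le fun t _ => sq_nonneg _
    have hinv : x⁻¹ ≤ 2 := by
      rw [inv_le_comm₀ hx0 two_pos]; linarith
    exact mul_le_mul hinv hmono hnn zero_le_two
  simp only [eval_comp, eval_sub, eval_mul, eval_C, eval_X, mul_zero, sub_zero] at h
  calc p.eval x ^ 2 ≤ _ := h
    _ ≤ (n + 1 : ℝ) ^ 2 * (2 * unitIntegral (p ^ 2)) := by gcongr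
    _ = _ := by ring

lemma eval_sq_le_unitIntegral {n : ℕ} {p : ℝ[X]} (hp : p.natDegree ≤ n) {x : ℝ}
    (hx : x ∈ Set.Icc (0 : ℝ) 1) :
    p.eval x ^ 2 ≤ 2 * (n + 1 : ℝ) ^ 2 * unitIntegral (p ^ 2) := by
  rcases le_total (1 / 2) x with h | h
  · exact eval_sq_le_unitIntegral_of_half_le hp h hx.2
  · have hdeg : (p.comp (1 - X)).natDegree ≤ n := by
      refine natDegree_comp_le.trans ?_
      have : (1 - X : ℝ[X]).natDegree ≤ 1 := by compute_degree
      nlinarith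
    have key := eval_sq_le_unitIntegral_of_half_le hdeg (x := 1 - x) (by linarith)
      (by linarith [hx.1])
    have hint : unitIntegral ((p.comp (1 - X)) ^ 2) = unitIntegral (p ^ 2) := by
      simp only [unitIntegral_apply, eval_pow, eval_comp, eval_sub, eval_one, eval_X]
      simpa using intervalIntegral.integral_comp_sub_left (a := 0) (b := 1)
        (fun t => p.eval t ^ 2) 1
    rw [hint] at key
    simpa using key

/-- The squared `L²` norm of the monic Jacobi polynomial of degree `m` for the weight
`t ^ A * (1 - t) ^ B` on `[0,1]`. -/
noncomputable def jacobiNormSq (m A B : ℕ) : ℝ :=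
  (m ! * (m + A)! * (m + B)! * (m + A + B)!) / ((2 * m + A + B)! * (2 * m + A + B + 1)!)

lemma jacobiNormSq_pos (m A B : ℕ) : 0 < jacobiNormSq m A B := by
  unfold jacobiNormSq; positivity

lemma exists_monic_jacobi (m A B : ℕ) : ∃ P : ℝ[X], P.Monic ∧ P.natDegree = m ∧
    ∀ p : ℝ[X], p.Monic → p.natDegree = m →
      unitIntegral (p * P * (X ^ A * (1 - X) ^ B)) = jacobiNormSq m A B := by
  have hlin : (1 - X : ℝ[X]).natDegree = 1 := by
    rw [← natDegree_neg, neg_sub, ← C_1, natDegree_X_sub_C]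
  have hlc : (1 - X : ℝ[X]).leadingCoeff = -1 := by
    rw [← neg_sub, leadingCoeff_neg, ← C_1, leadingCoeff_X_sub_C]
  have hne : (1 - X : ℝ[X]) ≠ 0 := by
    intro h; rw [h] at hlc; simp at hlc
  set F : ℝ[X] := X ^ (m + A) * (1 - X) ^ (m + B) with hF
  set W : ℝ[X] := X ^ A * (1 - X) ^ B with hW
  have hFdeg : F.natDegree = 2 * m + A + B := by
    rw [hF, natDegree_mul (by simp) (pow_ne_zero _ hne), natDegree_pow, natDegree_pow, hlin]
    simp; ring
  have hFlc : F.leadingCoeff = (-1) ^ (m + B) := by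
    rw [hF, leadingCoeff_mul, leadingCoeff_pow, leadingCoeff_pow, hlc]; simp
  have hWdeg : W.natDegree = A + B := by
    rw [hW, natDegree_mul (by simp) (pow_ne_zero _ hne), natDegree_pow, natDegree_pow, hlin]
    simp
  have hWlc : W.leadingCoeff = (-1) ^ B := by
    rw [hW, leadingCoeff_mul, leadingCoeff_pow, leadingCoeff_pow, hlc]; simp
  have hW0 : W ≠ 0 := mul_ne_zero (by simp) (pow_ne_zero _ hne)
  obtain ⟨R, hR⟩ : W ∣ derivative^[m] F := by
    refine IsCoprime.mul_dvd (IsCoprime.pow ⟨1, 1, by ring⟩) ?_ ?_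
    · simpa using pow_sub_dvd_iterate_derivative_of_pow_dvd m
        (Dvd.intro _ rfl : (X : ℝ[X]) ^ (m + A) ∣ F)
    · simpa using pow_sub_dvd_iterate_derivative_of_pow_dvd m
        (Dvd.intro_left _ rfl : (1 - X : ℝ[X]) ^ (m + B) ∣ F)
  set d : ℕ := (2 * m + A + B).descFactorial m with hd
  have hdpos : (0 : ℝ) < d := by
    rw [hd]; exact_mod_cast Nat.descFactorial_pos.2 (by omega)
  have hDcoeff : (derivative^[m] F).coeff (m + A + B) = d * (-1) ^ (m + B) := by
    rw [coeff_iterate_derivative, show m + A + B + m = 2 * m + A + B by ring, ← hd, ← hFdeg,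
      coeff_natDegree, hFlc, nsmul_eq_mul]
  have hDdeg : (derivative^[m] F).natDegree = m + A + B := by
    refine le_antisymm ((natDegree_iterate_derivative _ _).trans (by omega)) ?_
    refine le_natDegree_of_ne_zero ?_
    rw [hDcoeff]
    exact mul_ne_zero hdpos.ne' (pow_ne_zero _ (by norm_num))
  have hR0 : R ≠ 0 := by
    rintro rfl
    rw [hR, mul_zero, coeff_zero] at hDcoeff
    exact mul_ne_zero hdpos.ne' (pow_ne_zero _ (by norm_num)) hDcoeff.symm
  have hRdeg : R.natDegree = m := by
    have := natDegree_mul hW0 hR0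
    rw [← hR, hDdeg, hWdeg] at this
    omega
  have hRlc : R.leadingCoeff = d * (-1) ^ m := by
    have h := leadingCoeff_mul W R
    rw [← hR, leadingCoeff, hDdeg, hDcoeff, hWlc] at h
    have h1 : ((-1 : ℝ) ^ B) * (-1) ^ B = 1 := by rw [← mul_pow]; simp
    calc R.leadingCoeff = (-1 : ℝ) ^ B * ((-1) ^ B * R.leadingCoeff) := by
          rw [← mul_assoc, h1, one_mul]
      _ = d * (-1) ^ m * ((-1 : ℝ) ^ B * (-1) ^ B) := by rw [← h, pow_add]; ring
      _ = _ := by rw [h1, mul_one]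
  have hRlc0 : R.leadingCoeff ≠ 0 := leadingCoeff_ne_zero.2 hR0
  refine ⟨C R.leadingCoeff⁻¹ * R, ?_, ?_, ?_⟩
  · rw [mul_comm]; exact monic_mul_leadingCoeff_inv hR0
  · rw [natDegree_C_mul (inv_ne_zero hRlc0), hRdeg]
  · intro p hp hpm
    have e : p * (C R.leadingCoeff⁻¹ * R) * W = C R.leadingCoeff⁻¹ * (p * derivative^[m] F) := by
      rw [hR]; ring
    have hder : derivative^[m] p = C (m ! : ℝ) := by
      rw [eq_C_of_natDegree_le_zero (p := derivative^[m] p)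
        ((natDegree_iterate_derivative _ _).trans (by omega)), coeff_iterate_derivative,
        zero_add, Nat.descFactorial_self]
      have : p.coeff m = 1 := by rw [← hpm]; exact hp
      rw [this]; simp
    rw [e, unitIntegral_C_mul, unitIntegral_mul_iterate_derivative m p F
      (fun j hj => eval_iterate_derivative_eq_zero (q := X) (n := m + A) (by simp)
        (Dvd.intro _ rfl) (by omega))
      (fun j hj => eval_iterate_derivative_eq_zero (q := 1 - X) (n := m + B) (by simp)
        (Dvd.intro_left _ rfl) (by omega)), hder, unitIntegral_C_mul, hF, unitIntegral_beta, hRlc,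
      jacobiNormSq, show m + A + (m + B) + 1 = 2 * m + A + B + 1 by ring]
    have hdf : ((2 * m + A + B)! : ℝ) = (m + A + B)! * d := by
      have := Nat.factorial_mul_descFactorial (n := 2 * m + A + B) (k := m) (by omega)
      rw [show 2 * m + A + B - m = m + A + B by omega] at this
      exact_mod_cast this.symm
    rw [hdf]
    have hs : ((-1 : ℝ) ^ m) ≠ 0 := pow_ne_zero _ (by norm_num)
    field_simp

lemma jacobiNormSq_le_unitIntegral {m A B : ℕ} {p : ℝ[X]} (hp : p.Monic) (hm : p.natDegree = m) :
    jacobiNormSq m A B ≤ unitIntegral (p ^ 2 * (X ^ A * (1 - X) ^ B)) := by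
  obtain ⟨P, hP, hPm, h⟩ := exists_monic_jacobi m A B
  have hpos : 0 ≤ unitIntegral ((p - P) ^ 2 * (X ^ A * (1 - X) ^ B)) := by
    refine unitIntegral_nonneg fun t ht => ?_
    have h0 := ht.1
    have h1 : 0 ≤ 1 - t := sub_nonneg.2 ht.2
    simp only [eval_mul, eval_pow, eval_sub, eval_X, eval_one]
    positivity
  have hexp : (p - P) ^ 2 * (X ^ A * (1 - X) ^ B) = p ^ 2 * (X ^ A * (1 - X) ^ B) -
      (2 : ℝ) • (p * P * (X ^ A * (1 - X) ^ B)) + P * P * (X ^ A * (1 - X) ^ B) := by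
    rw [smul_eq_C_mul, map_ofNat]; ring
  rw [hexp, map_add, map_sub, map_smul, h p hp hm, h P hP hPm, smul_eq_mul] at hpos
  linarith

lemma le_intervalSup {a b : ℝ} (ha : 0 ≤ a) (hb : 0 ≤ b) (p : ℝ[X]) {t : ℝ}
    (ht : t ∈ Set.Icc (0 : ℝ) 1) : t ^ a * (1 - t) ^ b * |p.eval t| ≤ intervalSup a b p := by
  refine le_csSup (IsCompact.bddAbove (isCompact_Icc.image ?_)) ⟨t, ht, rfl⟩
  exact ((Real.continuous_rpow_const ha).mul
    ((Real.continuous_rpow_const hb).comp (continuous_const.sub continuous_id))).mul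
    p.continuous.abs

lemma sqrt_jacobiNormSq_le_intervalSup {a b : ℝ} (ha : 0 ≤ a) (hb : 0 ≤ b) {m : ℕ} {p : ℝ[X]}
    (hp : p.Monic) (hm : p.natDegree = m) :
    √(jacobiNormSq m (2 * ⌈a⌉₊) (2 * ⌈b⌉₊)) ≤ intervalSup a b p := by
  set S := intervalSup a b p
  have hpt : ∀ t ∈ Set.Icc (0 : ℝ) 1, t ^ ⌈a⌉₊ * (1 - t) ^ ⌈b⌉₊ * |p.eval t| ≤ S := by
    intro t ht
    refine le_trans ?_ (le_intervalSup ha hb p ht)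
    have h1 : 0 ≤ 1 - t := sub_nonneg.2 ht.2
    have h0 := ht.1
    have hA : t ^ ⌈a⌉₊ ≤ t ^ a := by
      rw [← Real.rpow_natCast]
      exact Real.rpow_le_rpow_of_exponent_ge_of_imp h0 ht.2 (Nat.le_ceil a)
        (fun _ h => by simpa using ((Nat.ceil_eq_zero.1 (by exact_mod_cast h))).antisymm ha)
    have hB : (1 - t) ^ ⌈b⌉₊ ≤ (1 - t) ^ b := by
      rw [← Real.rpow_natCast]
      exact Real.rpow_le_rpow_of_exponent_ge_of_imp h1 (by linarith) (Nat.le_ceil b)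
        (fun _ h => by simpa using ((Nat.ceil_eq_zero.1 (by exact_mod_cast h))).antisymm hb)
    gcongr
  have hS : 0 ≤ S := by
    refine le_trans ?_ (hpt 0 (by simp))
    simp only [sub_zero]; positivity
  refine Real.sqrt_le_iff.2 ⟨hS, (jacobiNormSq_le_unitIntegral hp hm).trans ?_⟩
  have : unitIntegral (p ^ 2 * (X ^ (2 * ⌈a⌉₊) * (1 - X) ^ (2 * ⌈b⌉₊))) ≤
      ∫ _ in (0 : ℝ)..1, S ^ 2 := by
    refine intervalIntegral.integral_mono_on zero_le_one
      ((Polynomial.continuous _).intervalIntegrable _ _) (by simp) fun t ht => ?_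
    have h1 : 0 ≤ 1 - t := sub_nonneg.2 ht.2
    have h0 := ht.1
    have h := pow_le_pow_left₀ (by positivity) (hpt t ht) 2
    calc _ = (t ^ ⌈a⌉₊ * (1 - t) ^ ⌈b⌉₊ * |p.eval t|) ^ 2 := by
          simp only [eval_mul, eval_pow, eval_sub, eval_X, eval_one]
          rw [mul_pow, sq_abs]; ring
      _ ≤ _ := h
  simpa using this

lemma sqrt_jacobiNormSq_le_devE {a b : ℝ} (ha : 0 ≤ a) (hb : 0 ≤ b) (m : ℕ) :
    √(jacobiNormSq m (2 * ⌈a⌉₊) (2 * ⌈b⌉₊)) ≤ devE m a b := by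
  refine le_csInf ⟨_, X ^ m, monic_X_pow m, natDegree_X_pow m, rfl⟩ ?_
  rintro _ ⟨p, hp, hm, rfl⟩
  exact sqrt_jacobiNormSq_le_intervalSup ha hb hp hm

lemma devE_le_sqrt_jacobiNormSq {a b : ℝ} (ha : 0 ≤ a) (hb : 0 ≤ b) (m : ℕ) :
    devE m a b ≤ √(2 * ((m + ⌊a⌋₊ + ⌊b⌋₊ : ℕ) + 1 : ℝ) ^ 2 *
      jacobiNormSq m (2 * ⌊a⌋₊) (2 * ⌊b⌋₊)) := by
  obtain ⟨P, hP, hPm, h⟩ := exists_monic_jacobi m (2 * ⌊a⌋₊) (2 * ⌊b⌋₊)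
  have hbdd : BddBelow {r : ℝ | ∃ p : ℝ[X], p.Monic ∧ p.natDegree = m ∧ r = intervalSup a b p} := by
    refine ⟨0, ?_⟩
    rintro _ ⟨p, hp, hm, rfl⟩
    exact (Real.sqrt_nonneg _).trans (sqrt_jacobiNormSq_le_intervalSup ha hb hp hm)
  refine (csInf_le hbdd ⟨P, hP, hPm, rfl⟩).trans ?_
  refine csSup_le ((Set.nonempty_Icc.2 zero_le_one).image _) ?_
  rintro _ ⟨t, ht, rfl⟩
  have h1 : 0 ≤ 1 - t := sub_nonneg.2 ht.2
  have h0 := ht.1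
  set f : ℝ[X] := X ^ ⌊a⌋₊ * (1 - X) ^ ⌊b⌋₊ * P with hf
  have hfdeg : f.natDegree ≤ m + ⌊a⌋₊ + ⌊b⌋₊ := by
    have : f.natDegree ≤ ⌊a⌋₊ + ⌊b⌋₊ + P.natDegree := by rw [hf]; compute_degree
    omega
  have hfint : unitIntegral (f ^ 2) = jacobiNormSq m (2 * ⌊a⌋₊) (2 * ⌊b⌋₊) := by
    rw [← h P hP hPm, hf]; congr 1; ring
  have hle : t ^ a * (1 - t) ^ b * |P.eval t| ≤ |f.eval t| := by
    have hA : t ^ a ≤ t ^ ⌊a⌋₊ := by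
      rw [← Real.rpow_natCast]
      exact Real.rpow_le_rpow_of_exponent_ge_of_imp h0 ht.2 (Nat.floor_le ha)
        (fun _ h => by rw [h]; simp)
    have hB : (1 - t) ^ b ≤ (1 - t) ^ ⌊b⌋₊ := by
      rw [← Real.rpow_natCast]
      exact Real.rpow_le_rpow_of_exponent_ge_of_imp h1 (by linarith) (Nat.floor_le hb)
        (fun _ h => by rw [h]; simp)
    have : |f.eval t| = t ^ ⌊a⌋₊ * (1 - t) ^ ⌊b⌋₊ * |P.eval t| := by
      rw [hf]
      simp only [eval_mul, eval_pow, eval_sub, eval_X, eval_one, abs_mul]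
      rw [abs_of_nonneg (pow_nonneg h0 _), abs_of_nonneg (pow_nonneg h1 _)]
    rw [this]
    gcongr
  refine hle.trans (Real.abs_le_sqrt ?_)
  rw [← hfint]
  exact eval_sq_le_unitIntegral hfdeg ht

lemma abs_log_factorial_sub_le (n : ℕ) :
    |Real.log n ! - (n * Real.log n - n)| ≤ Real.log (n + 1) + 1 := by
  rcases Nat.eq_zero_or_pos n with rfl | hn
  · simp
  have hn0 : (0 : ℝ) < n := by exact_mod_cast hn
  have hlog : Real.log (n / Real.exp 1) = Real.log n - 1 := by
    rw [Real.log_div hn0.ne' (Real.exp_ne_zero _), Real.log_exp]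
  have hform := Stirling.log_stirlingSeq_formula n
  rw [hlog, Real.log_mul two_ne_zero hn0.ne'] at hform
  obtain ⟨k, rfl⟩ := Nat.exists_eq_succ_of_ne_zero hn.ne'
  have hle : Real.log (Stirling.stirlingSeq (k + 1)) ≤ Real.log (Stirling.stirlingSeq 1) :=
    Real.log_le_log (Stirling.stirlingSeq'_pos k) (Stirling.stirlingSeq'_antitone (Nat.zero_le k))
  rw [Stirling.stirlingSeq_one, Real.log_div (Real.exp_ne_zero _) (by positivity), Real.log_exp,
    Real.log_sqrt two_pos.le] at hle
  have hlow : 0 ≤ Real.log (Stirling.stirlingSeq (k + 1)) := by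
    refine Real.log_nonneg (le_trans ?_ (Stirling.sqrt_pi_le_stirlingSeq k.succ_ne_zero))
    rw [Real.one_le_sqrt]; linarith [Real.pi_gt_three]
  have hmono : Real.log (k + 1 : ℕ) ≤ Real.log ((k + 1 : ℕ) + 1) :=
    Real.log_le_log hn0 (by linarith)
  have hnn : 0 ≤ Real.log (k + 1 : ℕ) := Real.log_natCast_nonneg _
  have h2 : 0 ≤ Real.log 2 := Real.log_nonneg one_le_two
  simp only [Nat.succ_eq_add_one] at *
  rw [abs_le]
  constructor <;> nlinarith

lemma tendsto_log_add_one_div {k : ℕ → ℕ} {s : ℕ → ℝ} {x : ℝ} (hs : Tendsto s atTop atTop)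
    (hk : Tendsto (fun j => (k j : ℝ) / s j) atTop (𝓝 x)) :
    Tendsto (fun j => Real.log (k j + 1) / s j) atTop (𝓝 0) := by
  have hinv : Tendsto (fun j => (s j)⁻¹) atTop (𝓝 0) := tendsto_inv_atTop_zero.comp hs
  have hup : Tendsto (fun j => 2 * √((k j / s j + (s j)⁻¹) * (s j)⁻¹)) atTop (𝓝 0) := by
    have := (((hk.add hinv).mul hinv).sqrt).const_mul 2
    simpa using this
  refine squeeze_zero' ?_ ?_ hup
  · filter_upwards [hs.eventually_gt_atTop 0] with j hj
    exact div_nonneg (Real.log_nonneg (by simp)) hj.le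
  · filter_upwards [hs.eventually_gt_atTop 0] with j hj
    have hy : (0 : ℝ) < k j + 1 := by positivity
    have e : (k j / s j + (s j)⁻¹) * (s j)⁻¹ = (k j + 1) / s j ^ 2 := by field_simp
    rw [e, Real.sqrt_div hy.le, Real.sqrt_sq hj.le, ← mul_div_assoc]
    gcongr
    have h1 := Real.log_sqrt hy.le
    have h2 := Real.log_le_sub_one_of_pos (Real.sqrt_pos.2 hy)
    linarith

lemma tendsto_log_factorial_div {k : ℕ → ℕ} {s : ℕ → ℝ} {x : ℝ} (hs : Tendsto s atTop atTop)
    (hk : Tendsto (fun j => (k j : ℝ) / s j) atTop (𝓝 x)) :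
    Tendsto (fun j => Real.log (k j)! / s j - k j / s j * Real.log (s j)) atTop
      (𝓝 (x * Real.log x - x)) := by
  have hmain := ((Real.continuous_mul_log.tendsto x).comp hk).sub hk
  have herr : Tendsto (fun j => (Real.log (k j)! - (k j * Real.log (k j) - k j)) / s j) atTop
      (𝓝 0) := by
    have hb := (tendsto_log_add_one_div hs hk).add (tendsto_inv_atTop_zero.comp hs)
    rw [add_zero] at hb
    refine squeeze_zero_norm' ?_ hb
    filter_upwards [hs.eventually_gt_atTop 0] with j hj
    rw [norm_div, Real.norm_eq_abs, Real.norm_of_nonneg hj.le]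
    have := div_le_div_of_nonneg_right (abs_log_factorial_sub_le (k j)) hj.le
    rwa [add_div, one_div] at this
  have := hmain.add herr
  rw [add_zero] at this
  refine this.congr' ?_
  filter_upwards [hs.eventually_gt_atTop 0] with j hj
  simp only [Function.comp_apply]
  rcases Nat.eq_zero_or_pos (k j) with h | h
  · simp [h]
  · rw [Real.log_div (by positivity) hj.ne']
    field_simp
    ring

lemma tendsto_log_jacobiNormSq_div {m A B : ℕ → ℕ} {s : ℕ → ℝ} {a b : ℝ}
    (hs : Tendsto s atTop atTop)
    (hm : Tendsto (fun j => (m j : ℝ) / s j) atTop (𝓝 (1 - a - b)))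
    (hA : Tendsto (fun j => (A j : ℝ) / s j) atTop (𝓝 a))
    (hB : Tendsto (fun j => (B j : ℝ) / s j) atTop (𝓝 b)) :
    Tendsto (fun j => Real.log (jacobiNormSq (m j) (2 * A j) (2 * B j)) / s j) atTop
      (𝓝 ((1 - a - b) * Real.log (1 - a - b) + (1 + a - b) * Real.log (1 + a - b) +
        (1 - a + b) * Real.log (1 - a + b) + (1 + a + b) * Real.log (1 + a + b) -
        4 * Real.log 2)) := by
  have h1 : Tendsto (fun j => ((m j + 2 * A j : ℕ) : ℝ) / s j) atTop (𝓝 (1 + a - b)) := by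
    convert hm.add (hA.const_mul 2) using 2 <;> [(push_cast; ring); ring]
  have h2 : Tendsto (fun j => ((m j + 2 * B j : ℕ) : ℝ) / s j) atTop (𝓝 (1 - a + b)) := by
    convert hm.add (hB.const_mul 2) using 2 <;> [(push_cast; ring); ring]
  have h3 : Tendsto (fun j => ((m j + 2 * A j + 2 * B j : ℕ) : ℝ) / s j) atTop
      (𝓝 (1 + a + b)) := by
    convert (hm.add (hA.const_mul 2)).add (hB.const_mul 2) using 2 <;> [(push_cast; ring); ring]
  have h4 : Tendsto (fun j => ((2 * m j + 2 * A j + 2 * B j : ℕ) : ℝ) / s j) atTop (𝓝 2) := by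
    convert ((hm.const_mul 2).add (hA.const_mul 2)).add (hB.const_mul 2) using 2 <;>
      [(push_cast; ring); ring]
  have key := ((((tendsto_log_factorial_div hs hm).add (tendsto_log_factorial_div hs h1)).add
    (tendsto_log_factorial_div hs h2)).add (tendsto_log_factorial_div hs h3)).sub
    (((tendsto_log_factorial_div hs h4).const_mul 2).add (tendsto_log_add_one_div hs h4))
  convert key using 2 with j
  · rw [jacobiNormSq, Nat.factorial_succ (2 * m j + 2 * A j + 2 * B j),
      Real.log_div (by positivity) (by positivity), Real.log_mul (by positivity) (by positivity),
      Real.log_mul (by positivity) (by positivity), Real.log_mul (by positivity) (by positivity),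
      Real.log_mul (by positivity) (by positivity), Nat.cast_mul,
      Real.log_mul (by positivity) (by positivity)]
    push_cast
    ring
  · ring

lemma tendsto_div_of_abs_sub_le {u v s : ℕ → ℝ} {a : ℝ} (hs : Tendsto s atTop atTop)
    (hu : Tendsto (fun j => u j / s j) atTop (𝓝 a)) (huv : ∀ j, |v j - u j| ≤ 1) :
    Tendsto (fun j => v j / s j) atTop (𝓝 a) := by
  have herr : Tendsto (fun j => (v j - u j) / s j) atTop (𝓝 0) := by
    refine squeeze_zero_norm' ?_ (tendsto_inv_atTop_zero.comp hs)
    filter_upwards [hs.eventually_gt_atTop 0] with j hj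
    rw [norm_div, Real.norm_eq_abs, Real.norm_of_nonneg hj.le]
    simpa using div_le_div_of_nonneg_right (huv j) hj.le
  have := hu.add herr
  rw [add_zero] at this
  exact this.congr fun j => by ring

lemma rpow_self_eq_exp {x : ℝ} (hx : 0 ≤ x) : x ^ x = Real.exp (x * Real.log x) := by
  rcases hx.eq_or_lt with rfl | h
  · simp
  · rw [Real.rpow_def_of_pos h, mul_comm]

lemma half_mul_log_half (x : ℝ) :
    x / 2 * Real.log (x / 2) = (x * Real.log x - x * Real.log 2) / 2 := by
  rcases eq_or_ne x 0 with rfl | h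
  · simp
  · rw [Real.log_div h two_ne_zero]; ring

/-- asymptotics of the weighted Chebyshev constant: if `m_j → ∞`,
`s_j = m_j + α_j + β_j`, `α_j/s_j → a` and `β_j/s_j → b`, then
`E_{m_j}(α_j,β_j)^{1/s_j} → ((1-a-b)/2)^{(1-a-b)/2} ((1+a+b)/2)^{(1+a+b)/2}
((1-a+b)/2)^{(1-a+b)/2} ((1+a-b)/2)^{(1+a-b)/2}` (real `rpow`, `0^0 = 1`). -/
theorem weighted_chebyshev_asymptotics (m : ℕ → ℕ) (α β : ℕ → ℝ)
    (hα : ∀ j, 0 ≤ α j) (hβ : ∀ j, 0 ≤ β j)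
    (hm : Filter.Tendsto m Filter.atTop Filter.atTop) (a b : ℝ)
    (ha : Filter.Tendsto (fun j => α j / ((m j : ℝ) + α j + β j)) Filter.atTop (nhds a))
    (hb : Filter.Tendsto (fun j => β j / ((m j : ℝ) + α j + β j)) Filter.atTop (nhds b)) :
    Filter.Tendsto
      (fun j => devE (m j) (α j) (β j) ^ (1 / ((m j : ℝ) + α j + β j)))
      Filter.atTop
      (nhds (((1 - a - b) / 2) ^ ((1 - a - b) / 2) * ((1 + a + b) / 2) ^ ((1 + a + b) / 2) *
        ((1 - a + b) / 2) ^ ((1 - a + b) / 2) * ((1 + a - b) / 2) ^ ((1 + a - b) / 2))) := by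
  set s : ℕ → ℝ := fun j => (m j : ℝ) + α j + β j with hsdef
  have hs : Tendsto s atTop atTop := by
    refine tendsto_atTop_mono (fun j => ?_) (tendsto_natCast_atTop_atTop.comp hm)
    simp only [Function.comp_apply, hsdef]
    linarith [hα j, hβ j]
  have hspos := hs.eventually_gt_atTop 0
  have hm' : Tendsto (fun j => (m j : ℝ) / s j) atTop (𝓝 (1 - a - b)) := by
    refine ((ha.const_sub 1).sub hb).congr' ?_
    filter_upwards [hspos] with j hj
    have hj' : (m j : ℝ) + α j + β j ≠ 0 := hj.ne'
    simp only [hsdef]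
    field_simp
    ring
  have ha0 : 0 ≤ a := ge_of_tendsto ha (hspos.mono fun j hj => div_nonneg (hα j) hj.le)
  have hb0 : 0 ≤ b := ge_of_tendsto hb (hspos.mono fun j hj => div_nonneg (hβ j) hj.le)
  have hab : 0 ≤ 1 - a - b :=
    ge_of_tendsto hm' (hspos.mono fun j hj => div_nonneg (Nat.cast_nonneg _) hj.le)
  have hceil {γ : ℕ → ℝ} (hγ : ∀ j, 0 ≤ γ j) (j : ℕ) : |(⌈γ j⌉₊ : ℝ) - γ j| ≤ 1 := by
    rw [abs_le]
    constructor <;> linarith [Nat.le_ceil (γ j), Nat.ceil_lt_add_one (hγ j)]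
  have hfloor {γ : ℕ → ℝ} (hγ : ∀ j, 0 ≤ γ j) (j : ℕ) : |(⌊γ j⌋₊ : ℝ) - γ j| ≤ 1 := by
    rw [abs_le]
    constructor <;> linarith [Nat.floor_le (hγ j), Nat.lt_floor_add_one (γ j)]
  have hfa := tendsto_div_of_abs_sub_le hs ha (hfloor hα)
  have hfb := tendsto_div_of_abs_sub_le hs hb (hfloor hβ)
  have hlow := tendsto_log_jacobiNormSq_div hs hm' (tendsto_div_of_abs_sub_le hs ha (hceil hα))
    (tendsto_div_of_abs_sub_le hs hb (hceil hβ))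
  have hup := tendsto_log_jacobiNormSq_div hs hm' hfa hfb
  have hdeg : Tendsto (fun j => ((m j + ⌊α j⌋₊ + ⌊β j⌋₊ : ℕ) : ℝ) / s j) atTop
      (𝓝 (1 - a - b + a + b)) :=
    ((hm'.add hfa).add hfb).congr fun j => by push_cast; ring
  have hextra : Tendsto (fun j => (Real.log 2 / s j +
      2 * (Real.log ((m j + ⌊α j⌋₊ + ⌊β j⌋₊ : ℕ) + 1) / s j))) atTop (𝓝 0) := by
    simpa using (hs.const_div_atTop (Real.log 2)).add
      ((tendsto_log_add_one_div hs hdeg).const_mul 2)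
  have hup' := (hextra.add hup).div_const 2
  rw [zero_add] at hup'
  have hpos (j : ℕ) : 0 < devE (m j) (α j) (β j) :=
    (Real.sqrt_pos.2 (jacobiNormSq_pos _ _ _)).trans_le
      (sqrt_jacobiNormSq_le_devE (hα j) (hβ j) (m j))
  have hlog := tendsto_of_tendsto_of_tendsto_of_le_of_le'
    (f := fun j => Real.log (devE (m j) (α j) (β j)) / s j) (hlow.div_const 2) hup' ?_ ?_
  · have hexp := (Real.continuous_exp.tendsto _).comp hlog
    convert hexp using 2 with j
    · rw [Function.comp_apply, Real.rpow_def_of_pos (hpos j), mul_one_div]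
    · rw [rpow_self_eq_exp (by linarith), rpow_self_eq_exp (by linarith),
        rpow_self_eq_exp (by linarith), rpow_self_eq_exp (by linarith), ← Real.exp_add,
        ← Real.exp_add, ← Real.exp_add]
      simp only [half_mul_log_half]
      congr 1
      ring
  · filter_upwards [hspos] with j hj
    have h := Real.log_le_log (Real.sqrt_pos.2 (jacobiNormSq_pos _ _ _))
      (sqrt_jacobiNormSq_le_devE (hα j) (hβ j) (m j))
    rw [Real.log_sqrt (jacobiNormSq_pos _ _ _).le] at h
    rw [div_right_comm]
    exact div_le_div_of_nonneg_right h hj.le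
  · filter_upwards [hspos] with j hj
    have h := Real.log_le_log (hpos j) (devE_le_sqrt_jacobiNormSq (hα j) (hβ j) (m j))
    have hJ := jacobiNormSq_pos (m j) (2 * ⌊α j⌋₊) (2 * ⌊β j⌋₊)
    rw [Real.log_sqrt (by positivity), Real.log_mul (by positivity) hJ.ne',
      Real.log_mul (by positivity) (by positivity), Real.log_pow] at h
    refine (div_le_div_of_nonneg_right h hj.le).trans_eq ?_
    push_cast
    ring
end
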